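/- arXiv:2603.29351 — 3 statements merged into one kernel-verified Lean document; each statement's English description precedes it below -/
import Mathlib

section
/- Let S > 0, let φ : 𝔻ⁿ(S) → ℂ be given by a multivariate power series φ(x) = Σ_{k∈ℕⁿ} c_k x^k converging absolutely for every x ∈ 𝔻ⁿ(S), and let N ∈ ℕ and M₂ > 0 be such that Σ_{|k| > N} |c_k|² S^{2|k|} ≤ M₂². Then for every R with 0 < R < S and every x ∈ 𝔻ⁿ(R), it holds that |φ(x) − (P_N φ)(x)| ≤ M₂·√( (1/(1 − (R/S)²))ⁿ − Σ_{m=0}^{N} C(n+m−1, m)·(R/S)^{2m} ), where C(n+m−1, m) denotes the binomial coefficient. -/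
theorem geo_hasSum (q : ℝ) (h0 : 0 ≤ q) (h1 : q < 1) (n : ℕ) :
    HasSum (fun k : Fin n → ℕ => q ^ (∑ i, k i)) ((1 / (1 - q)) ^ n) := by
  induction n with
  | zero =>
    simp
  | succ n ih =>
    have hg := hasSum_geometric_of_lt_one h0 h1
    have hs := hg.summable.mul_of_nonneg ih.summable (fun _ => pow_nonneg h0 _)
      (fun _ => pow_nonneg h0 _)
    have h := hg.mul ih hs
    rw [← (Fin.consEquiv (fun _ : Fin (n + 1) => ℕ)).hasSum_iff, pow_succ', one_div]
    rw [one_div] at h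
    have he : ((fun k : Fin (n + 1) → ℕ => q ^ (∑ i, k i)) ∘
        (Fin.consEquiv (fun _ : Fin (n + 1) => ℕ))) =
        fun p : ℕ × (Fin n → ℕ) => q ^ p.1 * q ^ (∑ i, p.2 i) := by
      funext p
      simp [Fin.consEquiv, Fin.sum_univ_succ, pow_add]
    rw [he]
    exact h

theorem card_level (n m : ℕ) :
    (Finset.piAntidiag (Finset.univ : Finset (Fin n)) m).card = (n + m - 1).choose m := by
  have h := Finset.card_finsuppAntidiag_nat_eq_choose (s := (Finset.univ : Finset (Fin n))) m
  rw [Finset.card_univ, Fintype.card_fin] at h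
  rw [← h]
  refine Finset.card_bij' (fun f _ => Finsupp.equivFunOnFinite.symm f) (fun f _ => f) ?_ ?_ ?_ ?_
  · intro f hf; simpa using hf
  · intro f hf; simpa using hf
  · intro f hf; rfl
  · intro f hf; ext; rfl

theorem low_hasSum (q : ℝ) (n N : ℕ) :
    HasSum (fun k : Fin n → ℕ => if (∑ i, k i) ≤ N then q ^ (∑ i, k i) else 0)
      (∑ m ∈ Finset.range (N + 1), ((n + m - 1).choose m : ℝ) * q ^ m) := by
  have h : ∀ m ∈ Finset.range (N + 1),
      HasSum (fun k : Fin n → ℕ => if (∑ i, k i) = m then q ^ m else 0)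
        (((n + m - 1).choose m : ℝ) * q ^ m) := by
    intro m _
    have := hasSum_sum_of_ne_finset_zero (L := SummationFilter.unconditional _)
      (f := fun k : Fin n → ℕ => if (∑ i, k i) = m then q ^ m else 0)
      (s := Finset.piAntidiag Finset.univ m) (by intro b hb; simp at hb; simp [hb])
    convert this using 1
    rw [Finset.sum_congr rfl (g := fun _ => q ^ m), Finset.sum_const, card_level, nsmul_eq_mul]
    intro k hk
    simp at hk
    simp [hk]
  convert hasSum_sum h using 2 with k
  simp

theorem tail_hasSum (q : ℝ) (h0 : 0 ≤ q) (h1 : q < 1) (n N : ℕ) :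
    HasSum (fun k : Fin n → ℕ => if N < (∑ i, k i) then q ^ (∑ i, k i) else 0)
      ((1 / (1 - q)) ^ n -
        ∑ m ∈ Finset.range (N + 1), ((n + m - 1).choose m : ℝ) * q ^ m) := by
  have hd := (geo_hasSum q h0 h1 n).sub (low_hasSum q n N)
  refine (congrArg (fun F => HasSum F _) (funext fun k => ?_)).mpr hd
  by_cases h : N < ∑ i, k i
  · simp [h, not_le.2 h]
  · simp [h, not_lt.1 h]


/-- error bound for the degree-N truncation of an analytic function
on a polydisc via the Cauchy–Schwarz inequality, from an ℓ²-bound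
`Σ_{|k|>N} |c_k|² S^{2|k|} ≤ M₂²` on the tail Taylor coefficients
(Proposition 3). -/
theorem stmt_2 (n : ℕ) (S : ℝ) (hS : 0 < S)
    (c : (Fin n → ℕ) → ℂ) (φ : (Fin n → ℝ) → ℂ)
    (hconv : ∀ x : Fin n → ℝ, (∀ i, |x i| < S) →
      Summable (fun k : Fin n → ℕ => ‖c k * ∏ i, (x i : ℂ) ^ k i‖))
    (hφ : ∀ x : Fin n → ℝ, (∀ i, |x i| < S) →
      φ x = ∑' k : Fin n → ℕ, c k * ∏ i, (x i : ℂ) ^ k i)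
    (N : ℕ) (M₂ : ℝ) (hM₂ : 0 < M₂)
    (hsum : Summable (fun k : Fin n → ℕ =>
      if N < ∑ i, k i then ‖c k‖ ^ 2 * S ^ (2 * ∑ i, k i) else 0))
    (hcoef : (∑' k : Fin n → ℕ,
        (if N < ∑ i, k i then ‖c k‖ ^ 2 * S ^ (2 * ∑ i, k i) else 0)) ≤ M₂ ^ 2)
    (R : ℝ) (hR : 0 < R) (hRS : R < S)
    (x : Fin n → ℝ) (hx : ∀ i, |x i| < R) :
    ‖φ x - ∑' k : Fin n → ℕ,
        (if (∑ i, k i) ≤ N then c k * ∏ i, (x i : ℂ) ^ k i else 0)‖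
      ≤ M₂ * Real.sqrt ((1 / (1 - (R / S) ^ 2)) ^ n -
          ∑ m ∈ Finset.range (N + 1), ((n + m - 1).choose m : ℝ) * (R / S) ^ (2 * m)) := by
  have hxS : ∀ i, |x i| < S := fun i => (hx i).trans hRS
  set r := R / S with hr
  have hr0 : 0 < r := div_pos hR hS
  have hr1 : r < 1 := (div_lt_one hS).2 hRS
  have hT := tail_hasSum (r ^ 2) (by positivity) (by nlinarith) n N
  simp only [← pow_mul] at hT
  have hA := (hconv x hxS)
  have hB : Summable (fun k : Fin n → ℕ =>
      (if (∑ i, k i) ≤ N then c k * ∏ i, (x i : ℂ) ^ k i else 0)) := by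
    refine Summable.of_norm_bounded hA ?_
    intro k
    split_ifs
    · exact le_rfl
    · rw [norm_zero]; exact norm_nonneg _
  set f : (Fin n → ℕ) → ℝ := fun k => if N < ∑ i, k i then ‖c k‖ * S ^ (∑ i, k i) else 0 with hf
  set g : (Fin n → ℕ) → ℝ := fun k => if N < ∑ i, k i then r ^ (∑ i, k i) else 0 with hg
  have hf0 : ∀ k, 0 ≤ f k := by
    intro k; simp only [hf]; split_ifs <;> positivity
  have hg0 : ∀ k, 0 ≤ g k := by
    intro k; simp only [hg]; split_ifs <;> positivity
  have hf2 : (fun k => f k ^ (2 : ℝ)) = (fun k : Fin n → ℕ =>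
      if N < ∑ i, k i then ‖c k‖ ^ 2 * S ^ (2 * ∑ i, k i) else 0) := by
    funext k
    rw [Real.rpow_two]
    simp only [hf]
    split_ifs
    · rw [mul_pow, ← pow_mul, mul_comm 2]
    · simp
  have hg2 : (fun k => g k ^ (2 : ℝ)) = (fun k : Fin n → ℕ =>
      if N < ∑ i, k i then r ^ (2 * ∑ i, k i) else 0) := by
    funext k
    rw [Real.rpow_two]
    simp only [hg]
    split_ifs
    · rw [← pow_mul, mul_comm 2]
    · simp
  obtain ⟨hs, hle⟩ := Real.summable_and_inner_le_Lp_mul_Lq_tsum_of_nonneg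
    Real.HolderConjugate.two_two hf0 hg0 (by rw [hf2]; exact hsum)
    (by rw [hg2]; exact hT.summable)
  rw [hf2, hg2, hT.tsum_eq, ← Real.sqrt_eq_rpow, ← Real.sqrt_eq_rpow] at hle
  rw [hφ x hxS, ← hA.of_norm.tsum_sub hB]
  refine (tsum_of_norm_bounded hs.hasSum ?_).trans (hle.trans ?_)
  · intro k
    simp only [hf, hg]
    by_cases h : N < ∑ i, k i
    · simp only [h, not_le.2 h, if_true, if_false, sub_zero]
      rw [norm_mul, mul_assoc, ← mul_pow, hr, mul_div_cancel₀ _ hS.ne', norm_prod,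
        ← Finset.prod_pow_eq_pow_sum]
      gcongr with i
      rw [norm_pow, Complex.norm_real, Real.norm_eq_abs]
      exact pow_le_pow_left₀ (abs_nonneg _) (hx i).le _
    · simp [h, not_lt.1 h]
  · gcongr
    exact (Real.sqrt_le_left hM₂.le).2 hcoef
end

section
/- Let D ⊆ ℝⁿ be open, let F, F̃ : D → ℝⁿ be continuous, let g₁,…,gₙ : D → ℂ be C¹ with F̃(x)·∇g_i(x) = λ_i g_i(x) on D for λ_i ∈ ℂ, and set λ_m = max_i Re(λ_i) and Ṽ = Σ_{i=1}^{n} |g_i|². Assume λ_m < 0, and that there are constants ε_j, δ_j > 0 (j = 1,…,n) with |F_j(x) − F̃_j(x)| < ε_j and |∂Ṽ/∂x_j(x)| < δ_j for all x ∈ D. Then for all x ∈ D, ∇Ṽ(x)·F(x) ≤ Σ_{j=1}^{n} ε_j δ_j + 2λ_m Ṽ(x); in particular ∇Ṽ(x)·F(x) < 0 whenever Ṽ(x) > Σ_{j=1}^{n} ε_j δ_j / (2|λ_m|). -/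
/-- Proposition 6, second part: if `Ṽ = Σ_i |g_i|²` is built
from eigenfunctions of the surrogate field `F̃` (`F̃·∇g_i = λ_i g_i` on `D`),
`λ_m = max_i Re(λ_i) < 0`, and on `D` the vector-field error satisfies
`|F_j − F̃_j| < ε_j` and the gradient bound `|∂Ṽ/∂x_j| < δ_j`, then
`∇Ṽ·F ≤ Σ_j ε_j δ_j + 2 λ_m Ṽ` on `D`; in particular `∇Ṽ(x)·F(x) < 0`
whenever `Ṽ(x) > Σ_j ε_j δ_j / (2 |λ_m|)`. Directional derivatives formalize
`F·∇f` as `fderiv ℝ f x (F x)` and `∂f/∂x_j` as `fderiv ℝ f x (Pi.single j 1)`. -/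
theorem stmt_13 (n : ℕ) (hn : 0 < n) (D : Set (Fin n → ℝ)) (hD : IsOpen D)
    (F Ft : (Fin n → ℝ) → (Fin n → ℝ))
    (hFc : ContinuousOn F D) (hFtc : ContinuousOn Ft D)
    (g : Fin n → (Fin n → ℝ) → ℂ) (hg : ∀ i, ContDiffOn ℝ 1 (g i) D)
    (lam : Fin n → ℂ)
    (heig : ∀ i, ∀ x ∈ D, fderiv ℝ (g i) x (Ft x) = lam i * g i x)
    (hlam : haveI : Nonempty (Fin n) := ⟨⟨0, hn⟩⟩; (⨆ i, (lam i).re) < 0)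
    (ε δ : Fin n → ℝ) (hε : ∀ j, 0 < ε j) (hδ : ∀ j, 0 < δ j)
    (hFerr : ∀ x ∈ D, ∀ j, |F x j - Ft x j| < ε j)
    (hgrad : ∀ x ∈ D, ∀ j,
      |fderiv ℝ (fun y => ∑ i, ‖g i y‖ ^ 2) x (Pi.single j (1 : ℝ))| < δ j) :
    haveI : Nonempty (Fin n) := ⟨⟨0, hn⟩⟩
    ∀ x ∈ D,
      fderiv ℝ (fun y => ∑ i, ‖g i y‖ ^ 2) x (F x)
          ≤ (∑ j, ε j * δ j) + 2 * (⨆ i, (lam i).re) * ∑ i, ‖g i x‖ ^ 2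
      ∧ ((∑ i, ‖g i x‖ ^ 2) > (∑ j, ε j * δ j) / (2 * |⨆ i, (lam i).re|) →
          fderiv ℝ (fun y => ∑ i, ‖g i y‖ ^ 2) x (F x) < 0) := by
  intro x hx
  set V : (Fin n → ℝ) → ℝ := fun y => ∑ i, ‖g i y‖ ^ 2 with hV
  set m : ℝ := ⨆ i, (lam i).re with hm
  have hgd : ∀ i, HasFDerivAt (g i) (fderiv ℝ (g i) x) x := fun i =>
    (((hg i).differentiableOn (by norm_num)).differentiableAt (hD.mem_nhds hx)).hasFDerivAt
  have hVd : HasFDerivAt V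
      (∑ i, 2 • (innerSL ℝ (g i x)).comp (fderiv ℝ (g i) x)) x :=
    HasFDerivAt.fun_sum fun i _ => (hgd i).norm_sq
  have h1 : fderiv ℝ V x (Ft x) ≤ 2 * m * ∑ i, ‖g i x‖ ^ 2 := by
    rw [hVd.fderiv, ContinuousLinearMap.sum_apply, Finset.mul_sum]
    apply Finset.sum_le_sum
    intro i _
    have hle : (lam i).re ≤ m := le_ciSup (f := fun i => (lam i).re) (Set.finite_range _).bddAbove i
    have hin : inner ℝ (g i x) (lam i * g i x) = (lam i).re * ‖g i x‖ ^ 2 := by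
      rw [Complex.inner, ← Complex.normSq_eq_norm_sq, Complex.normSq_apply]
      simp
      ring
    have : (2 • (innerSL ℝ (g i x)).comp (fderiv ℝ (g i) x)) (Ft x)
        = 2 * ((lam i).re * ‖g i x‖ ^ 2) := by
      rw [← hin, ← heig i x hx]
      simp
      ring
    rw [this]
    nlinarith [sq_nonneg ‖g i x‖, mul_le_mul_of_nonneg_right hle (sq_nonneg ‖g i x‖)]
  have h2 : fderiv ℝ V x (F x - Ft x) ≤ ∑ j, ε j * δ j := by
    have hd : F x - Ft x = ∑ j, (F x j - Ft x j) • (Pi.single j (1 : ℝ) : Fin n → ℝ) := by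
      ext k
      simp [Finset.sum_apply, Pi.single_apply]
    rw [hd, map_sum]
    apply Finset.sum_le_sum
    intro j _
    rw [map_smul, smul_eq_mul]
    refine (le_abs_self _).trans ?_
    rw [abs_mul]
    exact mul_le_mul (hFerr x hx j).le (hgrad x hx j).le (abs_nonneg _) (hε j).le
  have h3 : fderiv ℝ V x (F x) ≤ (∑ j, ε j * δ j) + 2 * m * ∑ i, ‖g i x‖ ^ 2 := by
    rw [map_sub] at h2
    linarith
  refine ⟨h3, fun h => lt_of_le_of_lt h3 ?_⟩
  have hm0 : m < 0 := hlam
  rw [abs_of_neg hm0, gt_iff_lt, div_lt_iff₀ (by linarith)] at h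
  linarith
end

section
/- Let F̃ : ℝⁿ → ℝⁿ be continuously differentiable with F̃(0) = 0, let g : ℝⁿ → ℂ be twice continuously differentiable in a neighborhood of 0, and let λ ∈ ℂ be such that F̃(x)·∇g(x) = λ g(x) for all x in a neighborhood of 0. If ∇g(0) ≠ 0, then J_{F̃}(0)ᵀ ∇g(0) = λ ∇g(0), where J_{F̃}(0) is the Jacobian matrix of F̃ at 0 (viewed as a complex matrix acting on ∇g(0) ∈ ℂⁿ); in particular λ is an eigenvalue of J_{F̃}(0). -/
/-- Proposition 7: if `F̃` is C¹ with `F̃(0) = 0`, `g` is C² near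
`0` and satisfies `F̃·∇g = λ g` near `0`, and `∇g(0) ≠ 0`, then
`J_{F̃}(0)ᵀ ∇g(0) = λ ∇g(0)`, i.e. for every `j`,
`Σ_k (∂F̃_k/∂x_j)(0) (∂g/∂x_k)(0) = λ (∂g/∂x_j)(0)`; in particular `λ` is an
eigenvalue of (the transpose of, hence of) the Jacobian `J_{F̃}(0)`. -/
theorem stmt_14 (n : ℕ) (Ft : (Fin n → ℝ) → (Fin n → ℝ))
    (hFt : ContDiff ℝ 1 Ft) (hFt0 : Ft 0 = 0)
    (g : (Fin n → ℝ) → ℂ) (lam : ℂ)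
    (U : Set (Fin n → ℝ)) (hU : U ∈ nhds (0 : Fin n → ℝ))
    (hg : ContDiffOn ℝ 2 g U)
    (heig : ∀ x ∈ U, fderiv ℝ g x (Ft x) = lam * g x)
    (hgrad0 : (fun j => fderiv ℝ g 0 (Pi.single j (1 : ℝ))) ≠ 0) :
    (∀ j, ∑ k, ((fderiv ℝ Ft 0 (Pi.single j (1 : ℝ)) k : ℝ) : ℂ)
            * fderiv ℝ g 0 (Pi.single k (1 : ℝ))
          = lam * fderiv ℝ g 0 (Pi.single j (1 : ℝ)))
    ∧ ∃ v : Fin n → ℂ, v ≠ 0 ∧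
        ∀ j, ∑ k, ((fderiv ℝ Ft 0 (Pi.single j (1 : ℝ)) k : ℝ) : ℂ) * v k
          = lam * v j := by
  have hgA : ContDiffAt ℝ 2 g 0 := hg.contDiffAt hU
  have hgd : DifferentiableAt ℝ g 0 := hgA.differentiableAt (by norm_num)
  have hg' : DifferentiableAt ℝ (fderiv ℝ g) 0 :=
    (hgA.fderiv_right (m := 1) (by norm_num)).differentiableAt (by norm_num)
  have hF : DifferentiableAt ℝ Ft 0 := hFt.contDiffAt.differentiableAt (by norm_num)
  have hev : (fun x => fderiv ℝ g x (Ft x)) =ᶠ[nhds 0] fun x => lam * g x :=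
    Filter.mem_of_superset hU heig
  have h1 := hg'.hasFDerivAt.clm_apply hF.hasFDerivAt
  have h2 := (hgd.hasFDerivAt.const_mul lam).congr_of_eventuallyEq hev
  have h3 := h1.unique h2
  have key : ∀ j, ∑ k, ((fderiv ℝ Ft 0 (Pi.single j (1 : ℝ)) k : ℝ) : ℂ)
            * fderiv ℝ g 0 (Pi.single k (1 : ℝ))
          = lam * fderiv ℝ g 0 (Pi.single j (1 : ℝ)) := by
    intro j
    have h4 := congrArg (fun L => L (Pi.single j (1 : ℝ))) h3
    simp [hFt0] at h4
    rw [← h4]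
    conv_rhs => rw [pi_eq_sum_univ' (fderiv ℝ Ft 0 (Pi.single j (1 : ℝ)))]
    rw [map_sum]
    refine Finset.sum_congr rfl fun k _ => ?_
    rw [← Complex.real_smul, ← map_smul]
  exact ⟨key, _, hgrad0, key⟩
end
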